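/- Let L : ℝᵖ → (n×n real matrices) be Fréchet differentiable at m₀ with L(m₀) invertible, let Q be a real d×n matrix, W a symmetric real d×d matrix, f ∈ ℝⁿ, y ∈ ℝᵈ, R a symmetric real p×p matrix, and α ∈ ℝ. Define u₀ = L(m₀)⁻¹ f and let λ ∈ ℝⁿ be the solution of the adjoint equation L(m₀)ᵀ λ = −QᵀW(Q u₀ − y). Then the reduced objective Ĵ(m) = ½(Q L(m)⁻¹ f − y)ᵀ W (Q L(m)⁻¹ f − y) + (α/2) mᵀRm is Fréchet differentiable at m₀, and its derivative is the linear functional h ↦ ⟨αRm₀, h⟩ + λᵀ ((L'(m₀) h) u₀), where L'(m₀) h denotes the derivative of L at m₀ applied to the direction h (an n×n matrix) and (L'(m₀) h) u₀ its product with the vector u₀. -/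

import Mathlib

open Matrix

attribute [local instance] Matrix.frobeniusNormedAddCommGroup Matrix.frobeniusNormedSpace

section Helpers

variable {E : Type*} [NormedAddCommGroup E] [NormedSpace ℝ E]
  {ι : Type*} [Fintype ι]

/-- The derivative of `m ↦ g(m)ᵀ S g(m)` for a symmetric matrix `S`. -/
theorem HasFDerivAt.dotProduct_mulVec_self {S : Matrix ι ι ℝ} (hS : S.IsSymm)
    {g : E → ι → ℝ} {g' : E →L[ℝ] ι → ℝ} {x : E} (hg : HasFDerivAt g g' x) :
    HasFDerivAt (fun m => g m ⬝ᵥ S *ᵥ g m)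
      ((2 : ℝ) • (dotProductBilin ℝ ℝ (S *ᵥ g x)).toContinuousLinearMap ∘L g') x := by
  have hB := ContinuousLinearMap.hasFDerivAt_of_bilinear
    ((dotProductBilin ℝ ℝ).compl₂ S.mulVecLin).toContinuousBilinearMap hg hg
  refine hB.congr_fderiv (ContinuousLinearMap.ext fun h => ?_)
  change g x ⬝ᵥ S *ᵥ g' h + g' h ⬝ᵥ S *ᵥ g x = 2 * (S *ᵥ g x ⬝ᵥ g' h)
  rw [dotProduct_mulVec, ← mulVec_transpose, hS.eq, dotProduct_comm (g' h)]
  ring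

variable [DecidableEq ι]

attribute [local instance] Matrix.frobeniusNormedRing Matrix.frobeniusNormedAlgebra

/-- The derivative of `m ↦ L(m)⁻¹` at a point where `L` is invertible. -/
theorem HasFDerivAt.matrix_nonsing_inv {L : E → Matrix ι ι ℝ} {L' : E →L[ℝ] Matrix ι ι ℝ} {x : E}
    (hL : HasFDerivAt L L' x) (hx : IsUnit (L x)) :
    HasFDerivAt (fun m => (L m)⁻¹)
      ((-ContinuousLinearMap.mulLeftRight ℝ (Matrix ι ι ℝ) (L x)⁻¹ (L x)⁻¹) ∘L L') x := by
  obtain ⟨A, hA⟩ := hx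
  have hinv := hasFDerivAt_ringInverse (𝕜 := ℝ) A
  rw [coe_units_inv, hA] at hinv
  simpa only [nonsing_inv_eq_ringInverse] using! hinv.comp x hL

end Helpers

/-- The derivative of the state `m ↦ L(m)⁻¹ f` is `h ↦ -L(x)⁻¹ (L'(x) h) L(x)⁻¹ f`. -/
theorem HasFDerivAt.exists_nonsing_inv_mulVec {E : Type*} [NormedAddCommGroup E] [NormedSpace ℝ E]
    {ι : Type*} [Fintype ι] [DecidableEq ι] {L : E → Matrix ι ι ℝ} {L' : E →L[ℝ] Matrix ι ι ℝ}
    {x : E} (hL : HasFDerivAt L L' x) (hx : IsUnit (L x)) (f : ι → ℝ) :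
    ∃ u' : E →L[ℝ] ι → ℝ, HasFDerivAt (fun m => (L m)⁻¹ *ᵥ f) u' x ∧
      ∀ h, u' h = -((L x)⁻¹ *ᵥ L' h *ᵥ (L x)⁻¹ *ᵥ f) := by
  let T : Matrix ι ι ℝ →L[ℝ] ι → ℝ :=
    (Matrix.toLin'.toLinearMap.flip f : Matrix ι ι ℝ →ₗ[ℝ] ι → ℝ).toContinuousLinearMap
  refine ⟨_, T.hasFDerivAt.comp x (hL.matrix_nonsing_inv hx), fun h => ?_⟩
  change (-((L x)⁻¹ * L' h * (L x)⁻¹)) *ᵥ f = _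
  simp only [neg_mulVec, mulVec_mulVec, Matrix.mul_assoc]

/-- Adjoint-state gradient formula for the reduced objective of a discretized
PDE-constrained inverse problem with state equation `L(m)u = f`. If `L` is
Fréchet differentiable at `m₀` with `L(m₀)` invertible, `u₀ = L(m₀)⁻¹ f`, and
`λ` solves the adjoint equation `L(m₀)ᵀ λ = −QᵀW(Q u₀ − y)`, then the reduced
objective `Ĵ(m) = ½(QL(m)⁻¹f − y)ᵀW(QL(m)⁻¹f − y) + (α/2) mᵀRm` is Fréchet
differentiable at `m₀` and its derivative is the linear functional
`h ↦ ⟨αRm₀, h⟩ + λᵀ((L'(m₀)h) u₀)`. -/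
theorem stmt_13 {n d p : ℕ}
    (L : (Fin p → ℝ) → Matrix (Fin n) (Fin n) ℝ)
    (m₀ : Fin p → ℝ)
    (L' : (Fin p → ℝ) →L[ℝ] Matrix (Fin n) (Fin n) ℝ)
    (hL : HasFDerivAt L L' m₀)
    (hLinv : IsUnit (L m₀))
    (Q : Matrix (Fin d) (Fin n) ℝ)
    (W : Matrix (Fin d) (Fin d) ℝ) (hW : W.IsSymm)
    (f : Fin n → ℝ) (y : Fin d → ℝ)
    (R : Matrix (Fin p) (Fin p) ℝ) (hR : R.IsSymm)
    (α : ℝ)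
    (u₀ : Fin n → ℝ) (hu₀ : u₀ = (L m₀)⁻¹.mulVec f)
    (lam : Fin n → ℝ)
    (hlam : (L m₀)ᵀ.mulVec lam = -(Qᵀ.mulVec (W.mulVec (Q.mulVec u₀ - y)))) :
    ∃ J' : (Fin p → ℝ) →L[ℝ] ℝ,
      HasFDerivAt
        (fun m : Fin p → ℝ =>
          (1 / 2) * ((Q.mulVec ((L m)⁻¹.mulVec f) - y) ⬝ᵥ
              W.mulVec (Q.mulVec ((L m)⁻¹.mulVec f) - y))
            + (α / 2) * (m ⬝ᵥ R.mulVec m)) J' m₀ ∧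
      (∀ h : Fin p → ℝ, J' h = (α • R.mulVec m₀) ⬝ᵥ h + lam ⬝ᵥ ((L' h).mulVec u₀)) := by
  obtain ⟨u', hu', hu'_apply⟩ := hL.exists_nonsing_inv_mulVec hLinv f
  rw [← hu₀] at hu'_apply
  have hres : HasFDerivAt (fun m => Q *ᵥ ((L m)⁻¹ *ᵥ f) - y)
      (Q.mulVecLin.toContinuousLinearMap ∘L u') m₀ :=
    (Q.mulVecLin.toContinuousLinearMap.hasFDerivAt.comp m₀ hu').sub_const y
  refine ⟨_, ((hres.dotProduct_mulVec_self hW).const_mul (1 / 2)).add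
    (((hasFDerivAt_id m₀).dotProduct_mulVec_self hR).const_mul (α / 2)), fun h => ?_⟩
  change (1 / 2) * (2 * (W *ᵥ (Q *ᵥ ((L m₀)⁻¹ *ᵥ f) - y) ⬝ᵥ Q *ᵥ u' h))
    + (α / 2) * (2 * (R *ᵥ m₀ ⬝ᵥ h)) = _
  have hadj : W *ᵥ (Q *ᵥ u₀ - y) ⬝ᵥ Q *ᵥ u' h = lam ⬝ᵥ L' h *ᵥ u₀ := by
    rw [dotProduct_mulVec, ← mulVec_transpose, ← neg_neg (Qᵀ *ᵥ _), ← hlam, hu'_apply,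
      neg_dotProduct_neg, mulVec_transpose, ← dotProduct_mulVec, mulVec_mulVec,
      mul_nonsing_inv _ ((isUnit_iff_isUnit_det _).mp hLinv), one_mulVec]
  rw [← hu₀, hadj, smul_dotProduct, smul_eq_mul]
  ring
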